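/- Let G be a finite bipartite simple graph with vertex parts A and B (every edge joins a vertex of A to a vertex of B) that is a forest, has at least one edge, and in which every vertex of A has degree different from 1. Then there exist two distinct vertices w, w′ ∈ B, each of degree exactly 1 in G, lying in the same connected component of G (and hence joined by a path in G). -/

import Mathlib

open scoped BigOperators

/-- A forest with finitely many edges, at least one of them, has two distinct leaves in a common
connected component. -/
theorem SimpleGraph.IsAcyclic.exists_ne_and_degree_eq_one_and_reachable {V : Type*}
    {G : SimpleGraph V} [Finite G.edgeSet] [G.LocallyFinite] (h : G.IsAcyclic) {x y : V}
    (hxy : G.Adj x y) :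
    ∃ u v, u ≠ v ∧ G.degree u = 1 ∧ G.degree v = 1 ∧ G.Reachable u v := by
  have : Nonempty V := ⟨x⟩
  have ⟨u, v, p, hp, hmax⟩ := SimpleGraph.Walk.exists_isPath_forall_isPath_length_le_length G
  have hnil : ¬p.Nil := by
    have := hmax x y hxy.toWalk (SimpleGraph.Walk.IsPath.of_adj hxy)
    rw [← SimpleGraph.Walk.length_eq_zero_iff]
    simp at this
    omega
  refine ⟨u, v, hp.nil_iff_eq.not.mp hnil, ?_, ?_, p.reachable⟩ <;>
    rw [SimpleGraph.degree_eq_one_iff_existsUnique_adj]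
  · refine ⟨_, p.adj_snd hnil, fun w hadj ↦ ?_⟩
    apply h.eq_snd_of_adj_start hp hadj
    have : ¬(p.cons hadj.symm).IsPath := by grind [SimpleGraph.Walk.length_cons]
    grind [hp.cons]
  · refine ⟨_, p.adj_penultimate hnil |>.symm, fun w hadj ↦ ?_⟩
    apply h.eq_penultimate_of_adj_end hp hadj
    have : ¬(p.concat hadj).IsPath := by grind [SimpleGraph.Walk.length_concat]
    grind [hp.concat]

/-- Let `G` be a finite bipartite simple graph with parts `A` and
`B` (every edge joins an `A`-vertex to a `B`-vertex) that is a forest, has at least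
one edge, and in which every vertex of `A` has degree different from `1`. Then
there exist two distinct vertices `w, w' ∈ B`, each of degree exactly `1`, lying in
the same connected component of `G` (hence joined by a path in `G`). -/
theorem forest_two_leaves_in_B {A B : Type*} [Fintype A] [Fintype B]
    [DecidableEq A] [DecidableEq B]
    (G : SimpleGraph (A ⊕ B)) [DecidableRel G.Adj]
    (hbip : ∀ v v', G.Adj v v' →
      (∃ a b, v = Sum.inl a ∧ v' = Sum.inr b) ∨
      (∃ b a, v = Sum.inr b ∧ v' = Sum.inl a))
    (hforest : G.IsAcyclic)
    (hedge : ∃ v v', G.Adj v v')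
    (hdegA : ∀ a : A, G.degree (Sum.inl a) ≠ 1) :
    ∃ w w' : B, w ≠ w' ∧
      G.degree (Sum.inr w) = 1 ∧ G.degree (Sum.inr w') = 1 ∧
      G.Reachable (Sum.inr w) (Sum.inr w') := by
  obtain ⟨x, y, hxy⟩ := hedge
  obtain ⟨u, v, hne, hu, hv, huv⟩ := hforest.exists_ne_and_degree_eq_one_and_reachable hxy
  rcases u with a | w
  · exact absurd hu (hdegA a)
  rcases v with a | w'
  · exact absurd hv (hdegA a)
  exact ⟨w, w', fun h ↦ hne (congrArg Sum.inr h), hu, hv, huv⟩
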